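/- arXiv:0711.0194 — 2 statements merged into one kernel-verified Lean document; each statement's English description precedes it below -/
import Mathlib

section
/- Let 0 < p ≤ 1/2 and let E₁* be the unique bounded solution of E(q) = 1 + r(q)·E(f₁(q)) on [0,1]. Then E₁*(q) ≤ q/p + (1 − q)/(1 − p) for all q ∈ [0,1]; that is, E₁* ≤ E₀*, where E₀*(q) = q/p + (1 − q)/(1 − p). -/
noncomputable section

/-- The rescaling map `f₁` of the modified Qflip procedure. -/
def f1 (p q : ℝ) : ℝ :=
  if q ≤ p then q / p
  else if q < 1 - p then (q - p) / (1 - p)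
  else (q - (1 - p)) / p

/-- The continuation probability `r`. -/
def r (p q : ℝ) : ℝ := if p < q ∧ q < 1 - p then 1 - p else p

/-- The unique bounded solution `E₁*` of `E(q) = 1 + r(q)·E(f₁(q))`, given by
`E₁*(q) = Σ_{n=0}^∞ Π_{j=0}^{n-1} r(f₁^j(q))`. -/
def E1star (p q : ℝ) : ℝ := ∑' n : ℕ, ∏ j ∈ Finset.range n, r p ((f1 p)^[j] q)

/-- `f₁` maps `[0,1]` to itself. -/
theorem f1_mem_Icc {p q : ℝ} (hp : 0 < p) (hp1 : p < 1) (hq : q ∈ Set.Icc (0 : ℝ) 1) :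
    f1 p q ∈ Set.Icc (0 : ℝ) 1 := by
  obtain ⟨h0, h1⟩ := hq
  have hp2 : 0 < 1 - p := by linarith
  unfold f1
  split_ifs
  · exact ⟨by positivity, by rw [div_le_one hp]; linarith⟩
  · exact ⟨div_nonneg (by linarith) hp2.le, by rw [div_le_one hp2]; linarith⟩
  · exact ⟨div_nonneg (by linarith) hp.le, by rw [div_le_one hp]; linarith⟩

theorem r_nonneg {p : ℝ} (hp : 0 < p) (q : ℝ) : 0 ≤ r p q := by
  unfold r
  split_ifs with h
  · linarith [h.1, h.2]
  · exact hp.le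

/-- `E₀*` is a supersolution of the equation that defines `E₁*`. -/
theorem one_add_r_mul_le {p : ℝ} (hp : 0 < p) (hp' : p ≤ 1 / 2) (q : ℝ) :
    1 + r p q * (f1 p q / p + (1 - f1 p q) / (1 - p)) ≤ q / p + (1 - q) / (1 - p) := by
  have hp2 : 0 < 1 - p := by linarith
  have hp3 : 1 - p ≠ 0 := hp2.ne'
  unfold f1 r
  by_cases h1 : q ≤ p
  · rw [if_pos h1, if_neg (fun h => not_lt.2 h1 h.1)]
    apply le_of_eq
    field_simp
    ring
  by_cases h2 : q < 1 - p
  · rw [if_neg h1, if_pos h2, if_pos ⟨not_le.1 h1, h2⟩]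
    apply le_of_eq
    field_simp
    ring
  · rw [if_neg h1, if_neg h2, if_neg (fun h => h2 h.2)]
    have h : 1 + p * ((q - (1 - p)) / p / p + (1 - (q - (1 - p)) / p) / (1 - p))
        = q / p + (1 - q) / (1 - p) + (2 - 1 / p) := by
      field_simp
      ring
    have h3 : 2 ≤ 1 / p := by
      rw [le_div_iff₀ hp]
      linarith
    linarith

theorem sum_range_prod_r_le {p : ℝ} (hp : 0 < p) (hp' : p ≤ 1 / 2) (n : ℕ) :
    ∀ q ∈ Set.Icc (0 : ℝ) 1,
      ∑ k ∈ Finset.range n, ∏ j ∈ Finset.range k, r p ((f1 p)^[j] q) ≤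
        q / p + (1 - q) / (1 - p) := by
  have hp1 : p < 1 := by linarith
  induction n with
  | zero =>
    intro q hq
    simpa using add_nonneg (div_nonneg hq.1 hp.le)
      (div_nonneg (sub_nonneg.2 hq.2) (sub_nonneg.2 hp1.le))
  | succ n ih =>
    intro q hq
    have h : ∑ k ∈ Finset.range (n + 1), ∏ j ∈ Finset.range k, r p ((f1 p)^[j] q)
        = 1 + r p q *
          ∑ k ∈ Finset.range n, ∏ j ∈ Finset.range k, r p ((f1 p)^[j] (f1 p q)) := by
      rw [Finset.sum_range_succ', Finset.mul_sum, add_comm]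
      simp [Finset.prod_range_succ', mul_comm]
    rw [h]
    refine le_trans ?_ (one_add_r_mul_le hp hp' q)
    gcongr
    · exact r_nonneg hp q
    · exact ih _ (f1_mem_Icc hp hp1 hq)

/-- `E₁* ≤ E₀*` on `[0,1]`, where `E₀*(q) = q/p + (1-q)/(1-p)`. -/
theorem E1star_le_E0star (p : ℝ) (hp : 0 < p) (hp' : p ≤ 1 / 2) :
    ∀ q ∈ Set.Icc (0:ℝ) 1, E1star p q ≤ q / p + (1 - q) / (1 - p) := by
  intro q hq
  exact Real.tsum_le_of_sum_range_le
    (fun n => Finset.prod_nonneg fun j _ => r_nonneg hp _)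
    (fun n => sum_range_prod_r_le hp hp' n q hq)
end
end

section
/- Let 0 < p ≤ 1/2 with p ≤ (1 − p)², set c = max((1 − p)², 1 − (1 − p)²), and let E₁* and E₃* be the unique bounded solutions on [0,1] of E(q) = 1 + r(q)·E(f₁(q)) and E(q) = 1 + r(q)·E(f₃(q)), respectively. Then E₃*(q) ≤ E₁*(q) for all q ∈ [0,1]. -/
noncomputable section

/-- The rescaling map `f₃`, with breakpoint `c = max((1-p)², 1-(1-p)²)`. -/
def f3 (p q : ℝ) : ℝ :=
  if q ≤ p then q / p
  else if q ≤ max ((1 - p) ^ 2) (1 - (1 - p) ^ 2) then (q - p) / (1 - p)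
  else if q < 1 - p then q / (1 - p)
  else (q - (1 - p)) / p

/-- The unique bounded solution of `E(q) = 1 + r(q)·E(f₃(q))`. -/
def E3star (p q : ℝ) : ℝ := ∑' n : ℕ, ∏ j ∈ Finset.range n, r p ((f3 p)^[j] q)

lemma le_r (p q : ℝ) : p ≤ r p q := by
  unfold r; split_ifs <;> linarith

lemma r_le {p : ℝ} (hp' : p ≤ 1 / 2) (q : ℝ) : r p q ≤ 1 - p := by
  unfold r; split_ifs <;> linarith

lemma r_eq_of_mem {p q : ℝ} (h : p < q ∧ q < 1 - p) : r p q = 1 - p := if_pos h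

lemma r_eq_of_notMem {p q : ℝ} (h : ¬(p < q ∧ q < 1 - p)) : r p q = p := if_neg h

section Series

variable {p : ℝ}

lemma prod_r_nonneg (hp : 0 < p) (f : ℝ → ℝ) (q : ℝ) (n : ℕ) :
    0 ≤ ∏ j ∈ Finset.range n, r p (f^[j] q) :=
  Finset.prod_nonneg fun _ _ => hp.le.trans (le_r p _)

lemma prod_r_le (hp : 0 < p) (hp' : p ≤ 1 / 2) (f : ℝ → ℝ) (q : ℝ) (n : ℕ) :
    ∏ j ∈ Finset.range n, r p (f^[j] q) ≤ (1 - p) ^ n := by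
  simpa using Finset.prod_le_prod (s := Finset.range n) (f := fun j => r p (f^[j] q))
    (g := fun _ => 1 - p) (fun _ _ => hp.le.trans (le_r p _)) (fun _ _ => r_le hp' _)

lemma pow_le_prod_r (hp : 0 < p) (f : ℝ → ℝ) (q : ℝ) (n : ℕ) :
    p ^ n ≤ ∏ j ∈ Finset.range n, r p (f^[j] q) := by
  simpa using Finset.prod_le_prod (s := Finset.range n) (g := fun j => r p (f^[j] q))
    (f := fun _ => p) (fun _ _ => hp.le) (fun _ _ => le_r p _)

lemma summable_prod_r (hp : 0 < p) (hp' : p ≤ 1 / 2) (f : ℝ → ℝ) (q : ℝ) :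
    Summable fun n : ℕ => ∏ j ∈ Finset.range n, r p (f^[j] q) :=
  (summable_geometric_of_lt_one (by linarith : 0 ≤ 1 - p) (by linarith)).of_nonneg_of_le
    (prod_r_nonneg hp f q) (prod_r_le hp hp' f q)

lemma prod_r_succ (f : ℝ → ℝ) (q : ℝ) (n : ℕ) :
    ∏ j ∈ Finset.range (n + 1), r p (f^[j] q) =
      r p q * ∏ j ∈ Finset.range n, r p (f^[j] (f q)) := by
  rw [Finset.prod_range_succ', mul_comm]
  simp

/-- A nonnegative supersolution of `E(q) = 1 + r(q)·E(f(q))` dominates the series solution. -/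
lemma tsum_prod_r_le_of_supersolution (hp : 0 < p) (hp' : p ≤ 1 / 2) {f E : ℝ → ℝ}
    (hE : ∀ q, 0 ≤ E q) (hsup : ∀ q, 1 + r p q * E (f q) ≤ E q) (q : ℝ) :
    ∑' n : ℕ, ∏ j ∈ Finset.range n, r p (f^[j] q) ≤ E q := by
  refine (summable_prod_r hp hp' f q).tsum_le_of_sum_range_le fun N => ?_
  induction N generalizing q with
  | zero => simpa using hE q
  | succ N ih =>
    rw [Finset.sum_range_succ']
    simp only [prod_r_succ, ← Finset.mul_sum, Finset.range_zero, Finset.prod_empty]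
    have := mul_le_mul_of_nonneg_left (ih (f q)) (hp.le.trans (le_r p q))
    linarith [hsup q]

end Series

section E1

variable {p : ℝ}

lemma E1star_eq (hp : 0 < p) (hp' : p ≤ 1 / 2) (q : ℝ) :
    E1star p q = 1 + r p q * E1star p (f1 p q) := by
  unfold E1star
  rw [(summable_prod_r hp hp' (f1 p) q).tsum_eq_zero_add]
  simp only [prod_r_succ, tsum_mul_left, Finset.range_zero, Finset.prod_empty]

lemma E1star_le (hp : 0 < p) (hp' : p ≤ 1 / 2) (q : ℝ) : E1star p q ≤ p⁻¹ := by
  have h := (summable_prod_r hp hp' (f1 p) q).tsum_le_tsum (prod_r_le hp hp' (f1 p) q)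
    (summable_geometric_of_lt_one (by linarith : 0 ≤ 1 - p) (by linarith))
  rwa [tsum_geometric_of_lt_one (by linarith) (by linarith), sub_sub_cancel] at h

lemma le_E1star (hp : 0 < p) (hp' : p ≤ 1 / 2) (q : ℝ) : (1 - p)⁻¹ ≤ E1star p q := by
  have h := (summable_geometric_of_lt_one hp.le (by linarith)).tsum_le_tsum
    (pow_le_prod_r hp (f1 p) q) (summable_prod_r hp hp' (f1 p) q)
  rwa [tsum_geometric_of_lt_one hp.le (by linarith)] at h

lemma E1star_one (hp : 0 < p) (hp' : p ≤ 1 / 2) : E1star p 1 = (1 - p)⁻¹ := by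
  have h := E1star_eq hp hp' 1
  have hf : f1 p 1 = 1 := by
    rw [f1, if_neg (by linarith), if_neg (by linarith), sub_sub_cancel, div_self hp.ne']
  rw [hf, r_eq_of_notMem (by rintro ⟨-, h⟩; linarith)] at h
  exact eq_inv_of_mul_eq_one_left (by linarith)

lemma E1star_self (hp : 0 < p) (hp' : p ≤ 1 / 2) : E1star p p = (1 - p)⁻¹ := by
  have hp1 : 1 - p ≠ 0 := by linarith
  have hf : f1 p p = 1 := by rw [f1, if_pos le_rfl, div_self hp.ne']
  rw [E1star_eq hp hp', hf, r_eq_of_notMem (by simp), E1star_one hp hp']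
  field_simp
  ring

/-- Off `c < q < 1 - p` only the point `q = 1 - p = c` matters, where both values are explicit.
On `c < q < 1 - p`, one further step of the equation on each side reduces the claim to
`p * E ≤ 1 ≤ (1 - p) * E`. -/
lemma E1star_f3_le (hp : 0 < p) (hp' : p ≤ 1 / 2) (hpc : p ≤ (1 - p) ^ 2) (q : ℝ) :
    E1star p (f3 p q) ≤ E1star p (f1 p q) := by
  have hs : 0 < 1 - p := by linarith
  unfold f3 f1
  split_ifs with h1 h2 h3 h4
  · rfl
  · rfl
  · have hc : max ((1 - p) ^ 2) (1 - (1 - p) ^ 2) ≤ 1 - p := max_le (by nlinarith) (by linarith)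
    have hq : q = 1 - p := by linarith
    have hp2 : p = (1 - p) ^ 2 := by
      rcases le_max_iff.1 h2 with h | h
      · nlinarith
      · linarith
    have hqp : (q - p) / (1 - p) = p := by
      rw [div_eq_iff hs.ne']
      linarith
    rw [hqp, E1star_self hp hp']
    exact le_E1star hp hp' _
  · obtain ⟨hc1, hc2⟩ := max_lt_iff.1 (not_le.1 h2)
    have hx : 1 - p ≤ q / (1 - p) := by
      rw [le_div_iff₀ hs]; nlinarith
    have hy1 : p < (q - p) / (1 - p) := by
      rw [lt_div_iff₀ hs]; nlinarith
    have hy2 : (q - p) / (1 - p) < 1 - p := by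
      rw [div_lt_iff₀ hs]; nlinarith
    rw [E1star_eq hp hp' (q / (1 - p)), E1star_eq hp hp' ((q - p) / (1 - p)),
      r_eq_of_mem ⟨hy1, hy2⟩, r_eq_of_notMem fun h => h.2.not_ge hx]
    have hu := mul_le_mul_of_nonneg_left (E1star_le hp hp' (f1 p (q / (1 - p)))) hp.le
    have hl := mul_le_mul_of_nonneg_left (le_E1star hp hp' (f1 p ((q - p) / (1 - p)))) hs.le
    rw [mul_inv_cancel₀ hp.ne'] at hu
    rw [mul_inv_cancel₀ hs.ne'] at hl
    linarith
  · rfl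

end E1

/-- if `0 < p ≤ 1/2` and `p ≤ (1-p)²`, then `E₃* ≤ E₁*` on `[0,1]`. -/
theorem E3star_le_E1star (p : ℝ) (hp : 0 < p) (hp' : p ≤ 1 / 2)
    (hpc : p ≤ (1 - p) ^ 2) :
    ∀ q ∈ Set.Icc (0:ℝ) 1, E3star p q ≤ E1star p q := by
  intro q _
  refine tsum_prod_r_le_of_supersolution hp hp' (fun q => ?_) (fun q => ?_) q
  · exact (inv_nonneg.2 (by linarith)).trans (le_E1star hp hp' q)
  · rw [E1star_eq hp hp' q]
    gcongr
    · exact hp.le.trans (le_r p q)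
    · exact E1star_f3_le hp hp' hpc q
end
end
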